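/- Let α, τ, η, β be real numbers with α ≥ 2, τ > 0, η > 0, β > 0, and suppose: log(1+η) ≤ τ, α·(2^(α−1) − 1)/(τ·(α−1)) > 1, and β − 1/η > α·(2^(α−1) − 1)/(τ·(α−1)). Then the function f is quasiconvex on the interval [1, ∞). -/

import Mathlib

open Real Filter

/-- The function `f` from the paper (Eq. (33)):
`f(x) = x·(τ + log(1 + η/((x−1)ηβ + 1)))^(1−α)/(1−α) − (x−1)·τ^(1−α)/(1−α)`. -/
noncomputable def f (α τ η β : ℝ) : ℝ → ℝ := fun x =>
  x * (τ + Real.log (1 + η / ((x - 1) * η * β + 1))) ^ (1 - α) / (1 - α)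
    - (x - 1) * τ ^ (1 - α) / (1 - α)

/-- Convexity of `s ↦ s ^ p` on `[1, 2]`: its graph lies below the chord. -/
lemma one_add_rpow_sub_one_le {p t : ℝ} (hp : 1 ≤ p) (ht0 : 0 ≤ t) (ht1 : t ≤ 1) :
    (1 + t) ^ p - 1 ≤ t * ((2 : ℝ) ^ p - 1) := by
  have h := (convexOn_rpow hp).2 (show (1 : ℝ) ∈ Set.Ici 0 by simp)
    (show (2 : ℝ) ∈ Set.Ici 0 by simp) (sub_nonneg.2 ht1) ht0 (by ring)
  simp only [smul_eq_mul, one_rpow] at h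
  rw [show (1 - t) * 1 + t * 2 = 1 + t by ring] at h
  linarith

lemma rpow_bound_le_exp_bound {p τ k l : ℝ} (hp : 1 ≤ p) (hτ : 0 < τ) (hk1 : 1 ≤ k)
    (hk : (p + 1) * ((2 : ℝ) ^ p - 1) / (τ * p) ≤ k) (hl0 : 0 ≤ l) (hlτ : l ≤ τ) :
    (τ + l) / p * ((1 + l / τ) ^ p - 1) ≤ (1 - exp (-l)) * (1 + k * (exp l - 1)) := by
  have hp0 : 0 < p := by linarith
  let D : ℝ → ℝ := fun s => (1 - exp (-s)) * (1 + k * (exp s - 1))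
    - (τ + s) / p * ((1 + s / τ) ^ p - 1)
  have hD : ∀ s, 0 ≤ s → HasDerivAt D ((k * (exp s - 1) + (k - 1) * (1 - exp (-s)))
      - (p + 1) / p * ((1 + s / τ) ^ p - 1)) s := by
    intro s hs
    have hb : 0 < 1 + s / τ := by positivity
    have he : HasDerivAt (fun s : ℝ => exp (-s)) (-exp (-s)) s := by
      simpa using (hasDerivAt_neg s).exp
    have hr := (((hasDerivAt_id s).div_const τ).const_add 1).rpow_const
      (p := p) (Or.inl hb.ne')
    have h := ((he.const_sub 1).mul ((((hasDerivAt_exp s).sub_const 1).const_mul k).const_add 1)).sub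
      ((((hasDerivAt_id s).const_add τ).div_const p).mul (hr.sub_const 1))
    refine h.congr_deriv ?_
    have hpow : (1 + s / τ) ^ p = (1 + s / τ) ^ (p - 1) * (1 + s / τ) := by
      rw [← rpow_add_one hb.ne']; ring_nf
    simp only [id]
    rw [hpow]
    generalize (1 + s / τ) ^ (p - 1) = A
    field_simp
    ring
  have hmono : MonotoneOn D (Set.Icc 0 τ) := by
    refine monotoneOn_of_deriv_nonneg (convex_Icc 0 τ)
      (fun s hs => (hD s hs.1).continuousAt.continuousWithinAt) ?_ ?_
    · intro s hs
      rw [interior_Icc] at hs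
      exact (hD s hs.1.le).differentiableAt.differentiableWithinAt
    · intro s hs
      rw [interior_Icc] at hs
      rw [(hD s hs.1.le).deriv]
      have h1 := one_add_rpow_sub_one_le hp (t := s / τ) (div_nonneg hs.1.le hτ.le)
        ((div_le_one hτ).2 hs.2.le)
      have h2 : (p + 1) / p * ((1 + s / τ) ^ p - 1) ≤ k * s := calc
        _ ≤ (p + 1) / p * (s / τ * ((2 : ℝ) ^ p - 1)) := by gcongr
        _ = (p + 1) * ((2 : ℝ) ^ p - 1) / (τ * p) * s := by field_simp
        _ ≤ k * s := mul_le_mul_of_nonneg_right hk hs.1.le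
      have h3 : k * s ≤ k * (exp s - 1) :=
        mul_le_mul_of_nonneg_left (by linarith [add_one_le_exp s]) (by linarith)
      have h4 : 0 ≤ (k - 1) * (1 - exp (-s)) :=
        mul_nonneg (by linarith) (sub_nonneg.2 (exp_le_one_iff.2 (by linarith [hs.1])))
      linarith
  have h := hmono ⟨le_rfl, hτ.le⟩ ⟨hl0, hlτ⟩ hl0
  simp only [D] at h
  norm_num at h
  linarith

/-- Under the parameter bounds, `f` is even decreasing on `[1, ∞)`. -/
lemma antitoneOn_f {α τ η β : ℝ} (hα : 2 ≤ α) (hτ : 0 < τ) (hη : 0 < η) (hβ : 0 < β)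
    (h1 : log (1 + η) ≤ τ) (hk1 : 1 ≤ β - 1 / η)
    (hk : α * (2 ^ (α - 1) - 1) / (τ * (α - 1)) ≤ β - 1 / η) :
    AntitoneOn (f α τ η β) (Set.Ici 1) := by
  have hp0 : 0 < α - 1 := by linarith
  have hd : ∀ x, 1 ≤ x → ∃ d ≤ 0, HasDerivAt (f α τ η β) d x := by
    intro x hx
    obtain ⟨y, hy⟩ : ∃ y, y = (x - 1) * η * β + 1 := ⟨_, rfl⟩
    have hy1 : 1 ≤ y := by
      have : 0 ≤ (x - 1) * η * β := by
        have := sub_nonneg.2 hx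
        positivity
      linarith
    have hy0 : 0 < y := by linarith
    have hv0 : 0 < η / y := by positivity
    obtain ⟨l, hl⟩ : ∃ l, l = log (1 + η / y) := ⟨_, rfl⟩
    have hl0 : 0 ≤ l := hl ▸ log_nonneg (by linarith)
    have hlτ : l ≤ τ := by
      refine le_trans ?_ h1
      rw [hl]
      have := div_le_self hη.le hy1
      exact log_le_log (by linarith) (by linarith)
    have hel : exp l = 1 + η / y := by rw [hl, exp_log (by linarith)]
    have hu : 0 < τ + l := by linarith
    have hlin : HasDerivAt (fun x : ℝ => (x - 1) * η * β + 1) (η * β) x := by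
      simpa using ((((hasDerivAt_id x).sub_const 1).mul_const η).mul_const β).add_const 1
    have hL : HasDerivAt (fun x : ℝ => log (1 + η / ((x - 1) * η * β + 1)))
        (-(η ^ 2 * β) / (y * (y + η))) x := by
      have h := (((hasDerivAt_const x η).div hlin (by rw [← hy]; exact hy0.ne')).const_add 1).log
        (by simp only [Pi.div_apply]; rw [← hy]; linarith)
      refine h.congr_deriv ?_
      simp only [Pi.div_apply]
      rw [← hy]
      field_simp
      ring
    have hF := (((hasDerivAt_id x).mul ((hL.const_add τ).rpow_const (p := 1 - α)
      (Or.inl (by rw [← hy, ← hl]; exact hu.ne')))).div_const (1 - α)).sub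
      ((((hasDerivAt_id x).sub_const 1).mul_const (τ ^ (1 - α))).div_const (1 - α))
    refine ⟨_, ?_, hF⟩
    have key := rpow_bound_le_exp_bound (p := α - 1) (by linarith) hτ hk1
      (by simpa using hk) hl0 hlτ
    have hR : (1 - exp (-l)) * (1 + (β - 1 / η) * (exp l - 1))
        = x * (η ^ 2 * β / (y * (y + η))) := by
      rw [exp_neg, hel]
      have : x * (η * β) = y - 1 + η * β := by rw [hy]; ring
      field_simp
      linear_combination (-η ^ 2) * this
    rw [hR] at key
    simp only [id]
    rw [← hy, ← hl]
    have e1 : (1 + l / τ) ^ (α - 1) = (τ + l) ^ (α - 1) * τ ^ (1 - α) := by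
      rw [show 1 + l / τ = (τ + l) / τ by field_simp, div_rpow hu.le hτ.le,
        show 1 - α = -(α - 1) by ring, rpow_neg hτ.le]
      rfl
    have e2 : (τ + l) ^ (1 - α) = (τ + l) ^ (1 - α - 1) * (τ + l) := by
      rw [← rpow_add_one hu.ne']; ring_nf
    have e3 : (τ + l) ^ (1 - α - 1) * ((τ + l) * (τ + l) ^ (α - 1)) = 1 := by
      rw [mul_comm (τ + l), ← rpow_add_one hu.ne', ← rpow_add hu]
      ring_nf
      exact rpow_zero _
    rw [e1] at key
    have hA : 0 < (τ + l) ^ (1 - α - 1) := rpow_pos_of_pos hu _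
    have key' := mul_le_mul_of_nonneg_left key hA.le
    rw [e2]
    generalize (τ + l) ^ (1 - α - 1) = A at *
    generalize (τ + l) ^ (α - 1) = B at *
    generalize τ ^ (1 - α) = T at *
    have hα1 : 1 - α ≠ 0 := by linarith
    have : A * ((τ + l) / (α - 1) * (B * T - 1)) = (T - A * (τ + l)) / (α - 1) := by
      field_simp
      linear_combination T * e3
    rw [this] at key'
    calc _ = (T - A * (τ + l)) / (α - 1) - A * (x * (η ^ 2 * β / (y * (y + η)))) := by
          rw [show α - 1 = -(1 - α) by ring]
          field_simp
          ring
      _ ≤ 0 := by linarith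
  choose! d hd0 hd using hd
  refine antitoneOn_of_deriv_nonpos (convex_Ici 1)
    (fun x hx => (hd x hx).continuousAt.continuousWithinAt) ?_ ?_
  · intro x hx
    exact (hd x (interior_subset hx)).differentiableAt.differentiableWithinAt
  · intro x hx
    rw [(hd x (interior_subset hx)).deriv]
    exact hd0 x (interior_subset hx)

/-- for α ≥ 2 with log(1+η) ≤ τ, α(2^(α−1)−1)/(τ(α−1)) > 1 and
β − 1/η > α(2^(α−1)−1)/(τ(α−1)), the function f is quasiconvex on [1, ∞). -/
theorem stmt_4 (α τ η β : ℝ) (hα : 2 ≤ α)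
    (hτ : 0 < τ) (hη : 0 < η) (hβ : 0 < β)
    (h1 : Real.log (1 + η) ≤ τ)
    (h2 : α * (2 ^ (α - 1) - 1) / (τ * (α - 1)) > 1)
    (h3 : β - 1 / η > α * (2 ^ (α - 1) - 1) / (τ * (α - 1))) :
    QuasiconvexOn ℝ (Set.Ici (1 : ℝ)) (f α τ η β) :=
  (antitoneOn_f hα hτ hη hβ h1 (h2.trans h3).le h3.le).quasiconvexOn (convex_Ici 1)
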